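/- arXiv:1908.07615 — 4 statements merged into one kernel-verified Lean document; each statement's English description precedes it below -/
import Mathlib

section
/- Let τ, d, p be positive natural numbers, let x̂₀ ∈ ℝ^d, and for t = 0,…,τ−1 let φ_t : ℝ^d × ℝ^p → ℝ^d be differentiable. Define the trajectory functions x̃_t : ℝ^{τp} → ℝ^d by x̃_1(ū) = φ_0(x̂₀, u_0) and x̃_{t+1}(ū) = φ_t(x̃_t(ū), u_t). Fix ū ∈ ℝ^{τp} with x_t = x̃_t(ū), and let z̄ = (z_1; …; z_τ) ∈ ℝ^{τd}. Define the adjoint variables λ_τ = z_τ and λ_t = z_t + ∇_x φ_t(x_t, u_t) λ_{t+1} for t = τ−1, …, 1. Then the vector ∑_{s=1}^{τ} (D x̃_s(ū))* z_s ∈ ℝ^{τp} (where (D x̃_s(ū))* is the adjoint of the derivative of x̃_s at ū) has its t-th block of size p, for t = 0,…,τ−1, equal to ∇_u φ_t(x_t, u_t) λ_{t+1}. -/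
open ContinuousLinearMap in
/-- The adjoint of a coordinate projection of an `L²` product is the coordinate inclusion. -/
theorem PiLp.adjoint_proj_apply {ι E : Type*} [Fintype ι] [DecidableEq ι]
    [NormedAddCommGroup E] [InnerProductSpace ℝ E] [CompleteSpace E] (i : ι) (w : E) :
    adjoint (PiLp.proj 2 (fun _ : ι => E) i : PiLp 2 (fun _ : ι => E) →L[ℝ] E) w
      = PiLp.single 2 i w := by
  refine ext_inner_right ℝ fun v => ?_
  rw [adjoint_inner_left, PiLp.inner_apply, Finset.sum_eq_single i]
  · simp
  · intro j _ hj
    simp [hj]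
  · simp

/-- Chain rule for `v ↦ f (g v, h v)` in terms of the partial derivatives of `f`. -/
theorem HasFDerivAt.comp_prodMk_partial {V E F G : Type*}
    [NormedAddCommGroup V] [NormedSpace ℝ V] [NormedAddCommGroup E] [NormedSpace ℝ E]
    [NormedAddCommGroup F] [NormedSpace ℝ F] [NormedAddCommGroup G] [NormedSpace ℝ G]
    {f : E × F → G} {g : V → E} {h : V → F} {g' : V →L[ℝ] E} {h' : V →L[ℝ] F} {v : V}
    (hf : DifferentiableAt ℝ f (g v, h v)) (hg : HasFDerivAt g g' v) (hh : HasFDerivAt h h' v) :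
    HasFDerivAt (fun v => f (g v, h v))
      (fderiv ℝ (fun x => f (x, h v)) (g v) ∘L g'
        + fderiv ℝ (fun y => f (g v, y)) (h v) ∘L h') v := by
  have hfst : HasFDerivAt (fun x => f (x, h v)) _ (g v) :=
    hf.hasFDerivAt.comp (g v) (hasFDerivAt_prodMk_left (g v) (h v))
  have hsnd : HasFDerivAt (fun y => f (g v, y)) _ (h v) :=
    hf.hasFDerivAt.comp (h v) (hasFDerivAt_prodMk_right (g v) (h v))
  rw [hfst.fderiv, hsnd.fderiv]
  refine (hf.hasFDerivAt.comp v (hg.prodMk hh)).congr_fderiv ?_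
  ext w
  simp [← map_add]

open ContinuousLinearMap in
/-- Adjoint form of the chain rule for `v ↦ f (g v, v i)`: the adjoint derivative splits into the
contribution through `g` and the one through the `i`-th block. -/
theorem adjoint_fderiv_comp_prodMk_proj {ι E F G : Type*} [Fintype ι] [DecidableEq ι]
    [NormedAddCommGroup E] [InnerProductSpace ℝ E] [CompleteSpace E]
    [NormedAddCommGroup F] [InnerProductSpace ℝ F] [CompleteSpace F]
    [NormedAddCommGroup G] [InnerProductSpace ℝ G] [CompleteSpace G]
    {f : E × F → G} {g : PiLp 2 (fun _ : ι => F) → E} {v : PiLp 2 (fun _ : ι => F)} {i : ι}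
    (hf : DifferentiableAt ℝ f (g v, v i)) (hg : DifferentiableAt ℝ g v) (w : G) :
    adjoint (fderiv ℝ (fun v => f (g v, v i)) v) w
      = adjoint (fderiv ℝ g v) (adjoint (fderiv ℝ (fun x => f (x, v i)) (g v)) w)
        + PiLp.single 2 i (adjoint (fderiv ℝ (fun y => f (g v, y)) (v i)) w) := by
  rw [(HasFDerivAt.comp_prodMk_partial hf hg.hasFDerivAt
    (PiLp.hasFDerivAt_apply 2 v i)).fderiv, map_add, adjoint_comp, adjoint_comp, add_apply,
    comp_apply, comp_apply, PiLp.adjoint_proj_apply]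


/-- correctness of the gradient back-propagation (adjoint) recursion
for trajectory functions. -/
theorem backpropagation_adjoint_recursion
    (τ d p : ℕ) (hτ : 0 < τ) (hd : 0 < d) (hp : 0 < p)
    (x0 : EuclideanSpace ℝ (Fin d))
    (φ : Fin τ → EuclideanSpace ℝ (Fin d) × EuclideanSpace ℝ (Fin p) → EuclideanSpace ℝ (Fin d))
    (hφ : ∀ t, Differentiable ℝ (φ t))
    (X : ℕ → PiLp 2 (fun _ : Fin τ => EuclideanSpace ℝ (Fin p)) → EuclideanSpace ℝ (Fin d))
    (hX0 : X 0 = fun _ => x0)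
    (hXs : ∀ (t : ℕ) (ht : t < τ), X (t + 1) = fun u => φ ⟨t, ht⟩ (X t u, u ⟨t, ht⟩))
    (u : PiLp 2 (fun _ : Fin τ => EuclideanSpace ℝ (Fin p)))
    (z lam : ℕ → EuclideanSpace ℝ (Fin d))
    (hlamτ : lam τ = z τ)
    (hlam : ∀ (t : ℕ) (ht : t < τ), 1 ≤ t →
      lam t = z t
        + ContinuousLinearMap.adjoint
            (fderiv ℝ (fun x : EuclideanSpace ℝ (Fin d) => φ ⟨t, ht⟩ (x, u ⟨t, ht⟩)) (X t u))
            (lam (t + 1))) :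
    ∀ (t : ℕ) (ht : t < τ),
      (∑ s ∈ Finset.Icc 1 τ, ContinuousLinearMap.adjoint (fderiv ℝ (X s) u) (z s)) ⟨t, ht⟩
        = ContinuousLinearMap.adjoint
            (fderiv ℝ (fun w : EuclideanSpace ℝ (Fin p) => φ ⟨t, ht⟩ (X t u, w)) (u ⟨t, ht⟩))
            (lam (t + 1)) := by
  classical
  have hdiff : ∀ t ≤ τ, DifferentiableAt ℝ (X t) u := by
    intro t
    induction t with
    | zero => intro _; rw [hX0]; fun_prop
    | succ t ih =>
      intro ht
      rw [hXs t ht]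
      exact (HasFDerivAt.comp_prodMk_partial (hφ ⟨t, ht⟩ _) (ih (by lia)).hasFDerivAt
        (PiLp.hasFDerivAt_apply 2 u ⟨t, ht⟩)).differentiableAt
  have hstep : ∀ (t : ℕ) (ht : t < τ) (w : EuclideanSpace ℝ (Fin d)),
      ContinuousLinearMap.adjoint (fderiv ℝ (X (t + 1)) u) w
        = ContinuousLinearMap.adjoint (fderiv ℝ (X t) u)
            (ContinuousLinearMap.adjoint
              (fderiv ℝ (fun x => φ ⟨t, ht⟩ (x, u ⟨t, ht⟩)) (X t u)) w)
          + PiLp.single 2 ⟨t, ht⟩ (ContinuousLinearMap.adjoint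
              (fderiv ℝ (fun y => φ ⟨t, ht⟩ (X t u, y)) (u ⟨t, ht⟩)) w) := by
    intro t ht w
    rw [hXs t ht]
    exact adjoint_fderiv_comp_prodMk_proj (hφ ⟨t, ht⟩ _) (hdiff t ht.le) w
  have hzero : ∀ w, ContinuousLinearMap.adjoint (fderiv ℝ (X 0) u) w = 0 := by
    intro w
    simp [hX0]
  have hinv : ∀ t ≤ τ,
      ∑ s ∈ Finset.range t, ContinuousLinearMap.adjoint (fderiv ℝ (X s) u) (z s)
          + ContinuousLinearMap.adjoint (fderiv ℝ (X t) u) (lam t)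
        = ∑ k ∈ Finset.univ.filter (fun k : Fin τ => k.val < t),
            PiLp.single 2 k (ContinuousLinearMap.adjoint
              (fderiv ℝ (fun y => φ k (X k u, y)) (u k)) (lam (k + 1))) := by
    intro t
    induction t with
    | zero => intro _; simp [hzero]
    | succ t ih =>
      intro ht
      have hfilter : Finset.univ.filter (fun k : Fin τ => k.val < t + 1)
          = insert ⟨t, ht⟩ (Finset.univ.filter (fun k : Fin τ => k.val < t)) := by
        ext k
        simp only [Finset.mem_filter, Finset.mem_univ, true_and, Finset.mem_insert, Fin.ext_iff]
        lia
      have hadj : ContinuousLinearMap.adjoint (fderiv ℝ (X t) u) (lam t)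
          = ContinuousLinearMap.adjoint (fderiv ℝ (X t) u) (z t)
            + ContinuousLinearMap.adjoint (fderiv ℝ (X t) u)
              (ContinuousLinearMap.adjoint
                (fderiv ℝ (fun x => φ ⟨t, ht⟩ (x, u ⟨t, ht⟩)) (X t u)) (lam (t + 1))) := by
        rcases Nat.eq_zero_or_pos t with rfl | hpos
        · simp only [hzero, add_zero]
        · rw [← map_add, ← hlam t ht hpos]
      rw [hfilter, Finset.sum_insert (by simp), ← ih (by lia), Finset.sum_range_succ,
        hstep t ht, hadj]
      abel
  have hsum : ∑ s ∈ Finset.Icc 1 τ, ContinuousLinearMap.adjoint (fderiv ℝ (X s) u) (z s)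
      = ∑ k : Fin τ, PiLp.single 2 k (ContinuousLinearMap.adjoint
          (fderiv ℝ (fun y => φ k (X k u, y)) (u k)) (lam (k + 1))) := by
    have h := hinv τ le_rfl
    rw [hlamτ, ← Finset.sum_range_succ, Finset.sum_range_succ', hzero, add_zero] at h
    rw [Finset.filter_true_of_mem fun k _ => k.isLt] at h
    rw [← h, Finset.range_eq_Ico, Finset.sum_Ico_add' (fun s =>
      ContinuousLinearMap.adjoint (fderiv ℝ (X s) u) (z s))]
    rfl
  intro t ht
  rw [hsum, WithLp.ofLp_sum, Finset.sum_apply, Finset.sum_eq_single ⟨t, ht⟩]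
  · simp
  · intro k _ hk
    simp [hk.symm]
  · simp
end

section
/- Let τ, d, p be positive natural numbers, let x̂₀ ∈ ℝ^d, let φ_t : ℝ^d × ℝ^p → ℝ^d (t = 0,…,τ−1) be differentiable, let h_t : ℝ^d → ℝ (t = 1,…,τ) and g_t : ℝ^p → ℝ (t = 0,…,τ−1) be differentiable, and define the trajectory functions x̃_t by x̃_1(ū) = φ_0(x̂₀, u_0), x̃_{t+1}(ū) = φ_t(x̃_t(ū), u_t), and the objective f(ū) = ∑_{t=1}^{τ} h_t(x̃_t(ū)) + ∑_{t=0}^{τ−1} g_t(u_t). Fix ū with x_t = x̃_t(ū) and define λ_τ = ∇h_τ(x_τ) and λ_t = ∇h_t(x_t) + ∇_x φ_t(x_t, u_t) λ_{t+1} for t = τ−1, …, 1. Then f is differentiable at ū and for each t = 0,…,τ−1 the gradient of f with respect to the block u_t is ∇_{u_t} f(ū) = ∇_u φ_t(x_t, u_t) λ_{t+1} + ∇g_t(u_t). -/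
theorem fderiv_comp_prodMk_apply
    {W E F G : Type*} [NormedAddCommGroup W] [NormedSpace ℝ W] [NormedAddCommGroup E]
    [NormedSpace ℝ E] [NormedAddCommGroup F] [NormedSpace ℝ F] [NormedAddCommGroup G]
    [NormedSpace ℝ G] {Φ : E × F → G} {a : W → E} {b : W → F} {b' : W →L[ℝ] F} {w : W}
    (hΦ : DifferentiableAt ℝ Φ (a w, b w)) (ha : DifferentiableAt ℝ a w)
    (hb : HasFDerivAt b b' w) (v : W) :
    fderiv ℝ (fun w => Φ (a w, b w)) w v
      = fderiv ℝ (fun x => Φ (x, b w)) (a w) (fderiv ℝ a w v)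
        + fderiv ℝ (fun y => Φ (a w, y)) (b w) (b' v) := by
  have h : HasFDerivAt (fun w => Φ (a w, b w)) _ w :=
    hΦ.hasFDerivAt.comp w (ha.hasFDerivAt.prodMk hb)
  have h1 : HasFDerivAt (fun x => Φ (x, b w)) _ (a w) :=
    hΦ.hasFDerivAt.comp (a w) (hasFDerivAt_prodMk_left (a w) (b w))
  have h2 : HasFDerivAt (fun y => Φ (a w, y)) _ (b w) :=
    hΦ.hasFDerivAt.comp (b w) (hasFDerivAt_prodMk_right (a w) (b w))
  rw [h.fderiv, h1.fderiv, h2.fderiv]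
  simp [← map_add]

/-- Telescoping summation for a scalar costate recursion. -/
theorem sum_Icc_eq_sum_range_of_costate {R : Type*} [AddCommGroup R] {n : ℕ} (hn : 0 < n)
    {a l b : ℕ → R} (h_one : l 1 = b 0)
    (h_succ : ∀ t, 1 ≤ t → t < n → a t + l (t + 1) = l t + b t) (h_last : l n = a n) :
    ∑ t ∈ Finset.Icc 1 n, a t = ∑ t ∈ Finset.range n, b t := by
  have key : ∀ m < n, ∑ t ∈ Finset.Icc 1 m, a t + l (m + 1) = ∑ t ∈ Finset.range (m + 1), b t := by
    intro m
    induction m with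
    | zero => simp [h_one]
    | succ m ih =>
      intro hm
      rw [Finset.sum_Icc_succ_top (by lia), Finset.sum_range_succ, ← ih (by lia), add_assoc,
        h_succ _ (by lia) hm, add_assoc]
  obtain ⟨m, rfl⟩ := Nat.exists_eq_add_one.mpr hn
  rw [Finset.sum_Icc_succ_top (by lia), ← h_last, key m (by lia)]

/-- the backward pass of gradient back-propagation computes the block
gradients of the control objective. -/
theorem backward_pass_gradient
    (τ d p : ℕ) (hτ : 0 < τ) (hd : 0 < d) (hp : 0 < p)
    (x0 : EuclideanSpace ℝ (Fin d))
    (φ : Fin τ → EuclideanSpace ℝ (Fin d) × EuclideanSpace ℝ (Fin p) → EuclideanSpace ℝ (Fin d))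
    (hφ : ∀ t, Differentiable ℝ (φ t))
    (h : ℕ → EuclideanSpace ℝ (Fin d) → ℝ) (hh : ∀ t, Differentiable ℝ (h t))
    (g : Fin τ → EuclideanSpace ℝ (Fin p) → ℝ) (hg : ∀ t, Differentiable ℝ (g t))
    (X : ℕ → PiLp 2 (fun _ : Fin τ => EuclideanSpace ℝ (Fin p)) → EuclideanSpace ℝ (Fin d))
    (hX0 : X 0 = fun _ => x0)
    (hXs : ∀ (t : ℕ) (ht : t < τ), X (t + 1) = fun u => φ ⟨t, ht⟩ (X t u, u ⟨t, ht⟩))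
    (f : PiLp 2 (fun _ : Fin τ => EuclideanSpace ℝ (Fin p)) → ℝ)
    (hf : f = fun u => (∑ t ∈ Finset.Icc 1 τ, h t (X t u)) + ∑ t : Fin τ, g t (u t))
    (u : PiLp 2 (fun _ : Fin τ => EuclideanSpace ℝ (Fin p)))
    (lam : ℕ → EuclideanSpace ℝ (Fin d))
    (hlamτ : lam τ = gradient (h τ) (X τ u))
    (hlam : ∀ (t : ℕ) (ht : t < τ), 1 ≤ t →
      lam t = gradient (h t) (X t u)
        + ContinuousLinearMap.adjoint
            (fderiv ℝ (fun x : EuclideanSpace ℝ (Fin d) => φ ⟨t, ht⟩ (x, u ⟨t, ht⟩)) (X t u))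
            (lam (t + 1))) :
    DifferentiableAt ℝ f u ∧
    ∀ (t : ℕ) (ht : t < τ),
      gradient f u ⟨t, ht⟩
        = ContinuousLinearMap.adjoint
            (fderiv ℝ (fun w : EuclideanSpace ℝ (Fin p) => φ ⟨t, ht⟩ (X t u, w)) (u ⟨t, ht⟩))
            (lam (t + 1))
          + gradient (g ⟨t, ht⟩) (u ⟨t, ht⟩) := by
  have hcoord : ∀ t : Fin τ, HasFDerivAt
      (fun u : PiLp 2 (fun _ : Fin τ => EuclideanSpace ℝ (Fin p)) => u t)
      (PiLp.proj 2 (fun _ : Fin τ => EuclideanSpace ℝ (Fin p)) t : _ →L[ℝ] _) u :=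
    fun t => (PiLp.proj 2 (fun _ : Fin τ => EuclideanSpace ℝ (Fin p)) t).hasFDerivAt
  have hX : ∀ t ≤ τ, DifferentiableAt ℝ (X t) u := by
    intro t
    induction t with
    | zero => intro _; rw [hX0]; exact differentiableAt_const _
    | succ t ih =>
      intro ht
      rw [hXs t ht]
      exact (hφ _ _).comp u ((ih (by lia)).prodMk (hcoord _).differentiableAt)
  have hXv : ∀ (t : ℕ) (ht : t < τ) (v : PiLp 2 fun _ : Fin τ => EuclideanSpace ℝ (Fin p)),
      fderiv ℝ (X (t + 1)) u v
        = fderiv ℝ (fun x : EuclideanSpace ℝ (Fin d) => φ ⟨t, ht⟩ (x, u ⟨t, ht⟩)) (X t u)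
            (fderiv ℝ (X t) u v)
          + fderiv ℝ (fun w : EuclideanSpace ℝ (Fin p) => φ ⟨t, ht⟩ (X t u, w)) (u ⟨t, ht⟩)
            (v ⟨t, ht⟩) := by
    intro t ht v
    rw [hXs t ht]
    exact fderiv_comp_prodMk_apply (hφ _ _) (hX t ht.le) (hcoord ⟨t, ht⟩) v
  let B : Fin τ → EuclideanSpace ℝ (Fin p) := fun t =>
    ContinuousLinearMap.adjoint
      (fderiv ℝ (fun w : EuclideanSpace ℝ (Fin p) => φ t (X t u, w)) (u t)) (lam (t + 1))
  have hgrad : HasGradientAt f (WithLp.toLp 2 fun t => B t + gradient (g t) (u t)) u := by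
    have hF := (HasFDerivAt.fun_sum (u := Finset.Icc 1 τ) fun t ht =>
        ((hh t (X t u)).hasGradientAt.hasFDerivAt.comp u
          (hX t (Finset.mem_Icc.mp ht).2).hasFDerivAt)).add
      (HasFDerivAt.fun_sum (u := Finset.univ) fun t _ =>
        (hg t (u t)).hasGradientAt.hasFDerivAt.comp u (hcoord t))
    rw [hf]
    refine hasGradientAt_iff_hasFDerivAt.mpr (hF.congr_fderiv ?_)
    ext v
    have hsum : ∑ t ∈ Finset.Icc 1 τ, inner ℝ (gradient (h t) (X t u)) (fderiv ℝ (X t) u v)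
        = ∑ t : Fin τ, inner ℝ (B t) (v t) := by
      have hstep : ∀ (t : ℕ) (ht : t < τ), inner ℝ (lam (t + 1)) (fderiv ℝ (X (t + 1)) u v)
          = inner ℝ (ContinuousLinearMap.adjoint
              (fderiv ℝ (fun x : EuclideanSpace ℝ (Fin d) => φ ⟨t, ht⟩ (x, u ⟨t, ht⟩)) (X t u))
              (lam (t + 1)))
              (fderiv ℝ (X t) u v) + inner ℝ (B ⟨t, ht⟩) (v ⟨t, ht⟩) := by
        intro t ht
        simp only [B, hXv t ht, inner_add_right, ContinuousLinearMap.adjoint_inner_left]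
      rw [sum_Icc_eq_sum_range_of_costate hτ
        (l := fun t => inner ℝ (lam t) (fderiv ℝ (X t) u v))
        (b := fun t => if ht : t < τ then inner ℝ (B ⟨t, ht⟩) (v ⟨t, ht⟩) else 0),
        ← Fin.sum_univ_eq_sum_range]
      · simp
      · simp [hτ, hstep 0 hτ, hX0]
      · intro t h1 ht
        simp only [hstep t ht, ht, dite_true, hlam t ht h1, inner_add_left]
        ring
      · simp [hlamτ]
    simp only [add_apply, sum_apply, ContinuousLinearMap.comp_apply,
      InnerProductSpace.toDual_apply_apply, hsum, PiLp.proj_apply]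
    rw [PiLp.inner_apply, ← Finset.sum_add_distrib]
    simp only [inner_add_left]
  exact ⟨hgrad.differentiableAt, fun t ht => by rw [hgrad.gradient]⟩
end

section
/- Let E be a finite-dimensional real inner product space, let f : E → ℝ, let u ∈ E and γ > 0, and let c : E → ℝ be a convex function with c(u) = f(u). Suppose u⁺ ∈ E minimizes the function v ↦ c(v) + (1/(2γ))‖v − u‖² over E, and suppose the sufficient decrease condition f(u⁺) ≤ c(u⁺) + (1/(2γ))‖u⁺ − u‖² holds. Then f(u⁺) ≤ f(u) − (1/(2γ))‖u⁺ − u‖². -/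
/-- If `p` minimizes the proximal objective `v ↦ c v + k ‖v - u‖²` of a convex function `c`, then
the value of this objective at `u` exceeds its value at `p` by at least `k ‖p - u‖²`. -/
theorem ConvexOn.prox_value_add_sq_le {E : Type*} [SeminormedAddCommGroup E] [NormedSpace ℝ E]
    {c : E → ℝ} {u p : E} {k : ℝ} (hc : ConvexOn ℝ Set.univ c)
    (hmin : ∀ v, c p + k * ‖p - u‖ ^ 2 ≤ c v + k * ‖v - u‖ ^ 2) :
    c p + k * ‖p - u‖ ^ 2 + k * ‖p - u‖ ^ 2 ≤ c u := by
  set q := k * ‖p - u‖ ^ 2 with hq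
  have key : ∀ t : ℝ, 0 < t → t ≤ 1 → c p + q + q - c u ≤ t * q := by
    intro t ht ht1
    have hconv := hc.2 (Set.mem_univ p) (Set.mem_univ u) (sub_nonneg.2 ht1) ht.le
      (sub_add_cancel 1 t)
    have hnorm : ‖(1 - t) • p + t • u - u‖ = (1 - t) * ‖p - u‖ := by
      rw [show (1 - t) • p + t • u - u = (1 - t) • (p - u) by module, norm_smul,
        Real.norm_of_nonneg (sub_nonneg.2 ht1)]
    have hle := hmin ((1 - t) • p + t • u)
    rw [hnorm, mul_pow, mul_left_comm, ← hq] at hle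
    simp only [smul_eq_mul] at hconv
    refine le_of_mul_le_mul_left ?_ ht
    linarith
  by_contra! h
  have hδ : 0 < c p + q + q - c u := sub_pos.2 h
  have hδq := key 1 one_pos le_rfl
  have hq_pos : 0 < q := by linarith
  have hhalf := key ((c p + q + q - c u) / (2 * q)) (by positivity)
    ((div_le_one (by positivity)).2 (by linarith))
  have hmul : (c p + q + q - c u) / (2 * q) * q = (c p + q + q - c u) / 2 := by
    field_simp
  linarith

/-- sufficient decrease of the regularized Gauss–Newton step: if `u⁺`
minimizes the proximally regularized convex model and the sufficient decrease
condition holds, then the objective decreases by at least `(1/(2γ))‖u⁺ - u‖²`. -/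
theorem sufficient_decrease_step
    {E : Type*} [NormedAddCommGroup E] [InnerProductSpace ℝ E] [FiniteDimensional ℝ E]
    (f c : E → ℝ) (u uplus : E) (γ : ℝ) (hγ : 0 < γ)
    (hc : ConvexOn ℝ Set.univ c) (hcu : c u = f u)
    (hmin : ∀ v, c uplus + (1 / (2 * γ)) * ‖uplus - u‖ ^ 2
      ≤ c v + (1 / (2 * γ)) * ‖v - u‖ ^ 2)
    (hdec : f uplus ≤ c uplus + (1 / (2 * γ)) * ‖uplus - u‖ ^ 2) :
    f uplus ≤ f u - (1 / (2 * γ)) * ‖uplus - u‖ ^ 2 := by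
  linarith [hc.prox_value_add_sq_le hmin]
end

section
/- Let E be a finite-dimensional real inner product space, let f : E → ℝ, and let y ∈ E and δ > 0. Let c : E → ℝ be a convex function with c(y) = f(y) and c(v) ≤ f(v) for all v ∈ E. Suppose w minimizes v ↦ c(v) + (1/(2δ))‖v − y‖² over E and that f(w) ≤ c(w) + (1/(2δ))‖w − y‖². Then for every u ∈ E, f(w) ≤ f(u) + (1/(2δ)) (‖u − y‖² − ‖u − w‖²). -/
/-- A minimizer of a strongly convex function satisfies the quadratic growth inequality. -/
theorem StrongConvexOn.add_sq_norm_sub_le_of_isMinOn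
    {E : Type*} [NormedAddCommGroup E] [NormedSpace ℝ E] {s : Set E} {g : E → ℝ} {m : ℝ}
    {w u : E} (hg : StrongConvexOn s m g) (hmin : IsMinOn g s w) (hw : w ∈ s) (hu : u ∈ s) :
    g w + m / 2 * ‖u - w‖ ^ 2 ≤ g u := by
  have key : ∀ t ∈ Set.Ioo (0 : ℝ) 1, g w + (1 - t) * (m / 2 * ‖u - w‖ ^ 2) ≤ g u := by
    rintro t ⟨ht0, ht1⟩
    have hle := hg.2 hu hw ht0.le (sub_nonneg.2 ht1.le) (by ring)
    have hmem := hg.1 hu hw ht0.le (sub_nonneg.2 ht1.le) (by ring)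
    have hge := isMinOn_iff.1 hmin _ hmem
    simp only [smul_eq_mul] at hle
    refine le_of_mul_le_mul_left ?_ ht0
    linarith
  have hlim : Filter.Tendsto (fun t : ℝ => g w + (1 - t) * (m / 2 * ‖u - w‖ ^ 2))
      (nhdsWithin 0 (Set.Ioi 0)) (nhds (g w + (1 - 0) * (m / 2 * ‖u - w‖ ^ 2))) :=
    (Continuous.tendsto (by fun_prop) 0).mono_left nhdsWithin_le_nhds
  have hlimit := le_of_tendsto hlim
    (Filter.eventually_of_mem (Ioo_mem_nhdsGT one_pos) key)
  simpa using hlimit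

/-- Adding a quadratic centred at `y` to a convex function makes it strongly convex. -/
theorem ConvexOn.strongConvexOn_add_sq_norm_sub
    {E : Type*} [NormedAddCommGroup E] [InnerProductSpace ℝ E] {s : Set E} {c : E → ℝ}
    (hc : ConvexOn ℝ s c) (m : ℝ) (y : E) :
    StrongConvexOn s m (fun v => c v + m / 2 * ‖v - y‖ ^ 2) := by
  rw [strongConvexOn_iff_convex]
  have haffine : ConvexOn ℝ s (fun v => (-m) * inner ℝ y v + m / 2 * ‖y‖ ^ 2) :=
    (((-m) • innerSL ℝ y).toLinearMap.convexOn hc.1).add_const _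
  refine (hc.add haffine).congr fun v _ => ?_
  simp only [Pi.add_apply, norm_sub_sq_real, real_inner_comm y v]
  ring


/-- the three-point inequality for a regularized Gauss–Newton step on a
convex model that lower-bounds the objective. -/
theorem three_point_inequality
    {E : Type*} [NormedAddCommGroup E] [InnerProductSpace ℝ E] [FiniteDimensional ℝ E]
    (f c : E → ℝ) (y w : E) (δ : ℝ) (hδ : 0 < δ)
    (hc : ConvexOn ℝ Set.univ c) (hcy : c y = f y) (hcle : ∀ v, c v ≤ f v)
    (hmin : ∀ v, c w + (1 / (2 * δ)) * ‖w - y‖ ^ 2 ≤ c v + (1 / (2 * δ)) * ‖v - y‖ ^ 2)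
    (hdec : f w ≤ c w + (1 / (2 * δ)) * ‖w - y‖ ^ 2) :
    ∀ u : E, f w ≤ f u + (1 / (2 * δ)) * (‖u - y‖ ^ 2 - ‖u - w‖ ^ 2) := by
  intro u
  have hm : 1 / (2 * δ) = δ⁻¹ / 2 := by ring
  rw [hm] at hdec ⊢
  simp only [hm] at hmin
  have hgrowth := (hc.strongConvexOn_add_sq_norm_sub δ⁻¹ y).add_sq_norm_sub_le_of_isMinOn
    (isMinOn_iff.2 fun v _ => hmin v) (Set.mem_univ w) (Set.mem_univ u)
  linarith [hcle u]
end
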